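/- arXiv:2109.01865 — 2 statements merged into one kernel-verified Lean document; each statement's English description precedes it below -/
import Mathlib

section
/- Suppose E ∈ C¹(X,ℝ), let p(v) = t_v v + w_v^L (t_v ≥ 0, w_v^L ∈ L) be a peak selection of E with respect to L, and let k ≥ 1. Take v_0 ∈ S∖L, σ ∈ (0,1), 0 ≤ η_min < η_max ≤ 1, η_j ∈ [η_min, η_max] and α_j > 0 for j = 0,…,k−1. Set Q_0 = 1, C_0 = E(p(v_0)), t_j = t_{v_j}, g_j = ∇E(p(v_j)), and define v_{j+1} = v_j(α_j) = (v_j − α_j g_j)/‖v_j − α_j g_j‖, Q_{j+1} = η_j Q_j + 1, C_{j+1} = (η_j Q_j C_j + E(p(v_{j+1})))/Q_{j+1} for j = 0,…,k−1. Assume E(p(v_j(α_j))) ≤ C_j − σ α_j t_j ‖g_j‖² for j = 0,…,k−1. If (i) p is continuous at v_k, (ii) t_k = t_{v_k} > 0, and (iii) g_k = ∇E(p(v_k)) ≠ 0, then there exists α_k^A > 0 such that E(p(v_k(α))) < C_k − σ α t_k ‖g_k‖² for all α ∈ (0, α_k^A). -/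
open Filter Topology Set
open scoped RealInnerProductSpace ENNReal

noncomputable section

/-- The half subspace `[L, v] = {t • v + w : t ≥ 0, w ∈ L}`. -/
def halfspaceCone {X : Type*} [NormedAddCommGroup X] [InnerProductSpace ℝ X]
    (L : Submodule ℝ X) (v : X) : Set X :=
  {y | ∃ t : ℝ, 0 ≤ t ∧ ∃ w ∈ (L : Set X), y = t • v + w}

/-- The normalized gradient-step map `v(α) = (v - α g)/‖v - α g‖`. -/
def stepv {X : Type*} [NormedAddCommGroup X] [InnerProductSpace ℝ X] (v g : X) (α : ℝ) : X :=
  ‖v - α • g‖⁻¹ • (v - α • g)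

section PeakSelection

variable {X : Type*} [NormedAddCommGroup X] [InnerProductSpace ℝ X]

/-- A gradient at a local maximizer over `[L, v]` pairs nonpositively with every direction along
which the segment stays in `[L, v]`. -/
theorem inner_nonpos_of_isLocalMaxOn_halfspaceCone [CompleteSpace X] {E : X → ℝ}
    {L : Submodule ℝ X} {v x g w : X} {s : ℝ} (hg : HasGradientAt E g x)
    (hx : x ∈ halfspaceCone L v) (hmax : IsLocalMaxOn E (halfspaceCone L v) x)
    (hs : 0 ≤ s) (hw : w ∈ L) : ⟪g, s • v + w⟫ ≤ 0 := by
  have htan : s • v + w ∈ posTangentConeAt (halfspaceCone L v) x := by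
    refine mem_posTangentConeAt_of_frequently_mem (Eventually.frequently ?_)
    filter_upwards [self_mem_nhdsWithin] with θ hθ
    obtain ⟨r, hr, l, hl, rfl⟩ := hx
    have hθ' : 0 < θ := hθ
    exact ⟨r + θ * s, by positivity, l + θ • w, L.add_mem hl (L.smul_mem θ hw), by module⟩
  simpa using hmax.hasFDerivWithinAt_nonpos hg.hasFDerivAt.hasFDerivWithinAt htan

theorem inner_eq_zero_of_isLocalMaxOn_halfspaceCone [CompleteSpace X] {E : X → ℝ}
    {L : Submodule ℝ X} {v x g w : X} (hg : HasGradientAt E g x)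
    (hx : x ∈ halfspaceCone L v) (hmax : IsLocalMaxOn E (halfspaceCone L v) x)
    (hw : w ∈ L) : ⟪g, w⟫ = 0 := by
  have h₁ := inner_nonpos_of_isLocalMaxOn_halfspaceCone hg hx hmax le_rfl hw
  have h₂ := inner_nonpos_of_isLocalMaxOn_halfspaceCone hg hx hmax le_rfl (L.neg_mem hw)
  simp only [zero_smul, zero_add, inner_neg_right] at h₁ h₂
  linarith

theorem sub_smul_ne_zero_of_inner_nonpos {v g : X} {a : ℝ} (hv : v ≠ 0) (hgv : ⟪g, v⟫ ≤ 0)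
    (ha : 0 ≤ a) : v - a • g ≠ 0 := by
  intro h
  have h' : ⟪v - a • g, v⟫ = 0 := by rw [h, inner_zero_left]
  rw [inner_sub_left, real_inner_smul_left] at h'
  have hpos : 0 < ⟪v, v⟫ := real_inner_self_pos.2 hv
  nlinarith [mul_nonneg ha (neg_nonneg.2 hgv)]

theorem norm_stepv {v g : X} {a : ℝ} (h : v - a • g ≠ 0) : ‖stepv v g a‖ = 1 := by
  rw [stepv, norm_smul, norm_inv, norm_norm, inv_mul_cancel₀ (norm_ne_zero_iff.2 h)]

theorem stepv_notMem {L : Submodule ℝ X} {v g : X} {a : ℝ} (hv : v ∉ L)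
    (hgL : ∀ w ∈ L, ⟪g, w⟫ = 0) (hgv : ⟪g, v⟫ ≤ 0) (ha : 0 < a) : stepv v g a ∉ L := by
  intro h
  have hv0 : v ≠ 0 := fun h0 => hv (h0 ▸ L.zero_mem)
  have hne := sub_smul_ne_zero_of_inner_nonpos hv0 hgv ha.le
  have hmem : v - a • g ∈ L :=
    (L.smul_mem_iff (inv_ne_zero (norm_ne_zero_iff.2 hne))).1 h
  have h0 := hgL _ hmem
  rw [inner_sub_right, real_inner_smul_right] at h0
  have hg : g = 0 := by
    by_contra hg
    have : 0 < ⟪g, g⟫ := real_inner_self_pos.2 hg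
    nlinarith [mul_pos ha this]
  rw [hg, smul_zero, sub_zero] at hmem
  exact hv hmem

theorem tendsto_stepv {v g : X} (hv : ‖v‖ = 1) : Tendsto (stepv v g) (𝓝 0) (𝓝 v) := by
  have h : ContinuousAt (stepv v g) 0 := by
    unfold stepv
    have : ‖v - (0 : ℝ) • g‖ ≠ 0 := by simp [hv]
    fun_prop (disch := assumption)
  simpa [ContinuousAt, stepv, hv] using h

/-- The coefficient of `u` in a decomposition `p u = t u • u + w` with `w ∈ L` inherits the
continuity of `p` at points outside `L`. -/
theorem tendsto_coeff_of_tendsto {ι : Type*} {l : Filter ι} {L : Submodule ℝ X}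
    [L.HasOrthogonalProjection] {u x : ι → X} {s : ι → ℝ} {v y : X} {r : ℝ} (hv : v ∉ L)
    (hu : Tendsto u l (𝓝 v)) (hx : Tendsto x l (𝓝 y))
    (hdec : ∀ᶠ i in l, x i - s i • u i ∈ L) (hy : y - r • v ∈ L) : Tendsto s l (𝓝 r) := by
  set q : X := v - L.starProjection v with hq
  have hqL : ∀ w ∈ L, ⟪q, w⟫ = 0 := fun w hw => L.starProjection_inner_eq_zero v w hw
  have hqv : ⟪q, v⟫ ≠ 0 := by
    have hq0 : q ≠ 0 := fun h =>
      hv (Submodule.starProjection_eq_self_iff.1 (sub_eq_zero.1 h).symm)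
    have : ⟪q, v⟫ = ⟪q, q⟫ := by
      conv_rhs => rw [hq, inner_sub_right, ← hq, hqL _ (L.starProjection_apply_mem v), sub_zero]
    rw [this]
    exact (real_inner_self_pos.2 hq0).ne'
  have hcoef : ∀ {c : ℝ} {a b : X}, ⟪q, b⟫ ≠ 0 → a - c • b ∈ L → ⟪q, a⟫ / ⟪q, b⟫ = c := by
    intro c a b hb hmem
    have := hqL _ hmem
    rw [inner_sub_right, real_inner_smul_right] at this
    rw [div_eq_iff hb]
    linarith
  have hqu : Tendsto (fun i => ⟪q, u i⟫) l (𝓝 ⟪q, v⟫) := tendsto_const_nhds.inner hu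
  have hlim : Tendsto (fun i => ⟪q, x i⟫ / ⟪q, u i⟫) l (𝓝 r) := by
    rw [← hcoef hqv hy]
    exact (tendsto_const_nhds.inner hx).div hqu hqv
  refine hlim.congr' ?_
  filter_upwards [hdec, hqu.eventually_ne hqv] with i hi hne using hcoef hne hi

/-- Armijo-type decrease of the peak value along the normalized gradient step. -/
theorem eventually_peak_stepv_lt [CompleteSpace X] {E : X → ℝ} {L : Submodule ℝ X}
    [L.HasOrthogonalProjection] {p : X → X} {t : X → ℝ} {v g : X} {σ : ℝ}
    (hg : HasStrictFDerivAt E (InnerProductSpace.toDual ℝ X g) (p v))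
    (hmax : IsLocalMaxOn E (halfspaceCone L v) (p v))
    (hdec : ∀ u : X, ‖u‖ = 1 → 0 ≤ t u ∧ p u - t u • u ∈ L)
    (hv : ‖v‖ = 1) (hvL : v ∉ L) (hgv : ⟪g, v⟫ ≤ 0) (hσ : σ < 1)
    (hpc : ContinuousWithinAt p {u : X | ‖u‖ = 1} v) (htv : 0 < t v) (hg0 : g ≠ 0) :
    ∀ᶠ a in 𝓝[>] (0 : ℝ), E (p (stepv v g a)) < E (p v) - σ * a * t v * ‖g‖ ^ 2 := by
  have hv0 : v ≠ 0 := norm_ne_zero_iff.1 (by simp [hv])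
  have ha0 : Tendsto (fun a : ℝ => a) (𝓝[>] 0) (𝓝 0) := nhdsWithin_le_nhds
  have hunit : ∀ᶠ a in 𝓝[>] (0 : ℝ), ‖stepv v g a‖ = 1 := by
    filter_upwards [self_mem_nhdsWithin] with a ha
    exact norm_stepv (sub_smul_ne_zero_of_inner_nonpos hv0 hgv (le_of_lt ha))
  have hstep : Tendsto (stepv v g) (𝓝[>] 0) (𝓝 v) := (tendsto_stepv hv).comp ha0
  have hp : Tendsto (fun a => p (stepv v g a)) (𝓝[>] 0) (𝓝 (p v)) :=
    hpc.tendsto.comp (tendsto_nhdsWithin_iff.2 ⟨hstep, hunit⟩)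
  have ht : Tendsto (fun a => t (stepv v g a)) (𝓝[>] 0) (𝓝 (t v)) :=
    tendsto_coeff_of_tendsto hvL hstep hp (hunit.mono fun a ha => (hdec _ ha).2) (hdec v hv).2
  set s : ℝ → ℝ := fun a => t (stepv v g a) * ‖v - a • g‖⁻¹ with hs
  have hslim : Tendsto s (𝓝[>] 0) (𝓝 (t v)) := by
    have hn : Tendsto (fun a : ℝ => ‖v - a • g‖⁻¹) (𝓝[>] 0) (𝓝 1) := by
      have := ((tendsto_const_nhds (x := v)).sub
        (ha0.smul (tendsto_const_nhds (x := g)))).norm.inv₀ (by simp [hv])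
      simpa [hv] using this
    simpa using ht.mul hn
  have hsmul : ∀ a, s a • v - (a * s a) • g = t (stepv v g a) • stepv v g a := by
    intro a
    simp only [hs, stepv]
    module
  set q : ℝ → X := fun a => p (stepv v g a) + (a * s a) • g with hq
  have hqlim : Tendsto q (𝓝[>] 0) (𝓝 (p v)) := by
    simpa using hp.add ((ha0.mul hslim).smul (tendsto_const_nhds (x := g)))
  have hqcone : ∀ᶠ a in 𝓝[>] (0 : ℝ), q a ∈ halfspaceCone L v := by
    filter_upwards [hunit] with a ha
    refine ⟨s a, mul_nonneg (hdec _ ha).1 (by positivity), _, (hdec _ ha).2, ?_⟩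
    rw [← hsmul]
    simp only [hq]
    module
  have hqmax : ∀ᶠ a in 𝓝[>] (0 : ℝ), E (q a) ≤ E (p v) :=
    (tendsto_nhdsWithin_iff.2 ⟨hqlim, hqcone⟩).eventually hmax
  have hgn : 0 < ‖g‖ := norm_pos_iff.2 hg0
  have hlittle := ((hasStrictFDerivAt_iff_isLittleO.1 hg).def
    (c := (1 - σ) / 2 * ‖g‖) (mul_pos (by linarith) hgn))
  have hexp := (hp.prodMk_nhds hqlim).eventually hlittle
  have hsbig : ∀ᶠ a in 𝓝[>] (0 : ℝ), 0 < s a ∧ σ * t v < (1 + σ) / 2 * s a := by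
    refine (hslim.eventually_const_lt htv).and ?_
    exact (tendsto_const_nhds.mul hslim).eventually_const_lt (by nlinarith)
  filter_upwards [hqmax, hexp, hsbig, self_mem_nhdsWithin] with a h₁ h₂ h₃ ha
  replace ha : 0 < a := ha
  obtain ⟨hsa, h₃⟩ := h₃
  have hdiff : p (stepv v g a) - q a = -((a * s a) • g) := by simp [hq]
  simp only [hdiff, InnerProductSpace.toDual_apply_apply, inner_neg_right, real_inner_smul_right,
    real_inner_self_eq_norm_sq, norm_neg, norm_smul, Real.norm_eq_abs,
    abs_of_pos (mul_pos ha hsa)] at h₂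
  have h₄ := le_of_abs_le h₂
  nlinarith [mul_lt_mul_of_pos_right h₃ (mul_pos ha (pow_pos hgn 2))]

end PeakSelection

/-- Lemma 3.1: feasibility of the normalized ZH-type nonmonotone
step-size search after `k` successful ZH steps. -/
theorem statement9
    {X : Type*} [NormedAddCommGroup X] [InnerProductSpace ℝ X] [CompleteSpace X]
    (E : X → ℝ) (hE : ContDiff ℝ 1 E)
    (L : Submodule ℝ X) [FiniteDimensional ℝ L]
    (p : X → X)
    (hpsel : ∀ u : X, ‖u‖ = 1 →
      p u ∈ halfspaceCone L u ∧ IsLocalMaxOn E (halfspaceCone L u) (p u))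
    (t : X → ℝ) (wL : X → X)
    (hdecomp : ∀ u : X, ‖u‖ = 1 → p u = t u • u + wL u ∧ 0 ≤ t u ∧ wL u ∈ L)
    (k : ℕ) (hk : 1 ≤ k)
    (v0 : X) (hv0 : ‖v0‖ = 1) (hv0L : v0 ∉ L)
    (σ : ℝ) (hσ : σ ∈ Set.Ioo (0 : ℝ) 1)
    (ηmin ηmax : ℝ) (hηmin : 0 ≤ ηmin) (hηlt : ηmin < ηmax) (hηmax : ηmax ≤ 1)
    (η α : ℕ → ℝ)
    (hη : ∀ j < k, η j ∈ Set.Icc ηmin ηmax)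
    (hα : ∀ j < k, 0 < α j)
    (v : ℕ → X) (Q C : ℕ → ℝ)
    (hv00 : v 0 = v0) (hQ0 : Q 0 = 1) (hC0 : C 0 = E (p v0))
    (hrecv : ∀ j < k, v (j + 1) = stepv (v j) (gradient E (p (v j))) (α j))
    (hrecQ : ∀ j < k, Q (j + 1) = η j * Q j + 1)
    (hrecC : ∀ j < k, C (j + 1) = (η j * Q j * C j + E (p (v (j + 1)))) / Q (j + 1))
    (hZH : ∀ j < k,
      E (p (stepv (v j) (gradient E (p (v j))) (α j))) ≤
        C j - σ * α j * t (v j) * ‖gradient E (p (v j))‖ ^ 2)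
    (hpc : ContinuousWithinAt p {u : X | ‖u‖ = 1} (v k))
    (htk : 0 < t (v k))
    (hgk : gradient E (p (v k)) ≠ 0) :
    ∃ αA > 0, ∀ a : ℝ, 0 < a → a < αA →
      E (p (stepv (v k) (gradient E (p (v k))) a)) <
        C k - σ * a * t (v k) * ‖gradient E (p (v k))‖ ^ 2 := by
  have hgrad : ∀ x, HasGradientAt E (gradient E x) x := fun x =>
    (hE.contDiffAt.differentiableAt one_ne_zero).hasGradientAt
  have hE' : ∀ x, HasStrictFDerivAt E (InnerProductSpace.toDual ℝ X (gradient E x)) x := fun x =>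
    hE.contDiffAt.hasStrictFDerivAt' (hgrad x).hasFDerivAt one_ne_zero
  have hgL : ∀ u, ‖u‖ = 1 → ∀ w ∈ L, ⟪gradient E (p u), w⟫ = 0 := fun u hu w hw =>
    inner_eq_zero_of_isLocalMaxOn_halfspaceCone (hgrad _) (hpsel u hu).1 (hpsel u hu).2 hw
  have hgu : ∀ u, ‖u‖ = 1 → ⟪gradient E (p u), u⟫ ≤ 0 := fun u hu => by
    simpa using inner_nonpos_of_isLocalMaxOn_halfspaceCone (hgrad _) (hpsel u hu).1
      (hpsel u hu).2 zero_le_one L.zero_mem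
  have hvj : ∀ j ≤ k, ‖v j‖ = 1 ∧ v j ∉ L := by
    intro j
    induction j with
    | zero => exact fun _ => by rw [hv00]; exact ⟨hv0, hv0L⟩
    | succ j ih =>
      intro hj
      obtain ⟨h₁, h₂⟩ := ih (by omega)
      rw [hrecv j hj]
      have hne : v j ≠ 0 := norm_ne_zero_iff.1 (by simp [h₁])
      exact ⟨norm_stepv (sub_smul_ne_zero_of_inner_nonpos hne (hgu _ h₁) (hα j hj).le),
        stepv_notMem h₂ (hgL _ h₁) (hgu _ h₁) (hα j hj)⟩
  have hQ : ∀ j ≤ k, 1 ≤ Q j := by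
    intro j
    induction j with
    | zero => exact fun _ => hQ0.ge
    | succ j ih =>
      intro hj
      have hηj : 0 ≤ η j := hηmin.trans (hη j hj).1
      rw [hrecQ j hj]
      nlinarith [ih (by omega)]
  have hEC : E (p (v k)) ≤ C k := by
    obtain ⟨m, rfl⟩ : ∃ m, k = m + 1 := ⟨k - 1, by omega⟩
    have hm : m < m + 1 := m.lt_succ_self
    have hdecr := hZH m hm
    rw [← hrecv m hm] at hdecr
    have htm : 0 ≤ t (v m) := (hdecomp _ (hvj m hm.le).1).2.1
    have hnn : 0 ≤ σ * α m * t (v m) * ‖gradient E (p (v m))‖ ^ 2 := by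
      have := hα m hm
      have := hσ.1
      positivity
    have hηQ : 0 ≤ η m * Q m :=
      mul_nonneg (hηmin.trans (hη m hm).1) (zero_le_one.trans (hQ m hm.le))
    rw [hrecC m hm, hrecQ m hm, le_div_iff₀ (by linarith)]
    have hEm : E (p (v (m + 1))) ≤ C m := by linarith
    nlinarith [mul_le_mul_of_nonneg_left hEm hηQ]
  obtain ⟨hvk, hvkL⟩ := hvj k le_rfl
  have hdec : ∀ u : X, ‖u‖ = 1 → 0 ≤ t u ∧ p u - t u • u ∈ L := by
    intro u hu
    obtain ⟨h₁, h₂, h₃⟩ := hdecomp u hu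
    exact ⟨h₂, by rwa [sub_eq_iff_eq_add'.2 h₁]⟩
  obtain ⟨αA, hαA, h⟩ := mem_nhdsGT_iff_exists_Ioo_subset.1
    (eventually_peak_stepv_lt (hE' _) (hpsel _ hvk).2 hdec hvk hvkL (hgu _ hvk) hσ.2 hpc htk hgk)
  exact ⟨αA, hαA, fun a ha ha' => (h ⟨ha, ha'⟩ : _ < _).trans_le (by linarith)⟩
end
end

section
/- Under the setting of the normalized ZH-type nonmonotone LMM (Algorithm 2), suppose additionally that η_max < 1. Assume (i) p is continuous on V_0, (ii) t_k ≥ δ for some δ > 0 and all k, and (iii) inf_{k≥0} E(w_k) > −∞. Then: (c) ∑_{k=0}^∞ α_k ‖g_k‖² < ∞; (d) every accumulation point of {w_k} is a critical point of E not belonging to L; and (e) liminf_{k→∞} ‖g_k‖ = 0. -/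
open Filter Topology Set
open scoped RealInnerProductSpace ENNReal

noncomputable section

/-- The set `V₀ = {v = v⊥ + τ v₀^L ∈ S : v⊥ ∈ L⊥, 0 ≤ τ ≤ 1}`. -/
def V0 {X : Type*} [NormedAddCommGroup X] [InnerProductSpace ℝ X]
    (L : Submodule ℝ X) (v0L : X) : Set X :=
  {v | ‖v‖ = 1 ∧ ∃ w ∈ (Lᗮ : Set X), ∃ τ : ℝ, 0 ≤ τ ∧ τ ≤ 1 ∧ v = w + τ • v0L}

section Auxiliary

variable {X : Type*} [NormedAddCommGroup X] [InnerProductSpace ℝ X]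

theorem one_le_norm_sub_smul {v g : X} (hv : ‖v‖ = 1) (h : ⟪v, g⟫ = 0) (a : ℝ) :
    1 ≤ ‖v - a • g‖ := by
  have h1 : ‖v - a • g‖ ^ 2 = 1 + ‖a • g‖ ^ 2 := by
    rw [norm_sub_sq_real, inner_smul_right, h, hv]
    ring
  nlinarith [norm_nonneg (v - a • g), sq_nonneg ‖a • g‖]

theorem stepv_zero {v : X} (hv : ‖v‖ = 1) (g : X) : stepv v g 0 = v := by
  simp [stepv, hv]

theorem norm_stepv_sub_le {v g : X} (hv : ‖v‖ = 1) (h : ⟪v, g⟫ = 0) (a : ℝ) :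
    ‖stepv v g a - v‖ ≤ 2 * ‖a • g‖ := by
  have h1 := one_le_norm_sub_smul hv h a
  have h2 : ‖v - a • g‖ ≤ 1 + ‖a • g‖ := by simpa [hv] using norm_sub_le v (a • g)
  have h3 : ‖stepv v g a - (v - a • g)‖ ≤ ‖a • g‖ := by
    have : stepv v g a - (v - a • g) = (‖v - a • g‖⁻¹ - 1) • (v - a • g) := by
      rw [stepv, sub_smul, one_smul]
    rw [this, norm_smul, Real.norm_eq_abs, abs_of_nonpos (by linarith [inv_le_one_of_one_le₀ h1])]
    have : ‖v - a • g‖⁻¹ * ‖v - a • g‖ = 1 := inv_mul_cancel₀ (by linarith)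
    linarith
  calc ‖stepv v g a - v‖ = ‖(stepv v g a - (v - a • g)) - a • g‖ := by congr 1; abel
    _ ≤ _ := (norm_sub_le _ _).trans (by linarith)

theorem stepv_mem_V0 {L : Submodule ℝ X} {v0L v g : X} (hv : v ∈ V0 L v0L) (hg : g ∈ Lᗮ)
    (h : ⟪v, g⟫ = 0) (a : ℝ) : stepv v g a ∈ V0 L v0L := by
  obtain ⟨hv1, w, hw, τ, hτ0, hτ1, hvw⟩ := hv
  have h1 := one_le_norm_sub_smul hv1 h a
  refine ⟨?_, ‖v - a • g‖⁻¹ • (w - a • g),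
    Lᗮ.smul_mem _ (Lᗮ.sub_mem hw (Lᗮ.smul_mem _ hg)), ‖v - a • g‖⁻¹ * τ, by positivity,
    mul_le_one₀ (inv_le_one_of_one_le₀ h1) hτ0 hτ1, ?_⟩
  · rw [stepv, norm_smul, norm_inv, norm_norm, inv_mul_cancel₀ (by linarith)]
  · rw [stepv, mul_smul, ← smul_add]
    nth_rw 2 [hvw]
    congr 1
    abel

open scoped Pointwise in
theorem isClosed_V0 (L : Submodule ℝ X) (v0L : X) : IsClosed (V0 L v0L) := by
  have h : V0 L v0L =
      {v | ‖v‖ = 1} ∩ ((Lᗮ : Set X) + (fun τ : ℝ => τ • v0L) '' Icc 0 1) := by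
    ext v
    simp only [V0, mem_inter_iff, mem_ofPred_eq, Set.mem_add, mem_image, mem_Icc]
    constructor
    · rintro ⟨hv, w, hw, τ, h0, h1, rfl⟩
      exact ⟨hv, w, hw, _, ⟨τ, ⟨h0, h1⟩, rfl⟩, rfl⟩
    · rintro ⟨hv, w, hw, _, ⟨τ, ⟨h0, h1⟩, rfl⟩, rfl⟩
      exact ⟨hv, w, hw, τ, h0, h1, rfl⟩
  rw [h]
  refine (isClosed_eq continuous_norm continuous_const).inter ?_
  exact (Submodule.isClosed_orthogonal L).add_right_of_isCompact
    (isCompact_Icc.image (by fun_prop))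

theorem starProjection_orthogonal_add {L : Submodule ℝ X} [FiniteDimensional ℝ L] {u w : X}
    (hu : u ∈ Lᗮ) (hw : w ∈ L) : Lᗮ.starProjection (u + w) = u :=
  Submodule.eq_starProjection_of_mem_orthogonal' hu
    (Submodule.le_orthogonal_orthogonal L hw) rfl

/-- The component orthogonal to `L` does not shrink on `V0`. -/
theorem norm_le_norm_starProjection_of_mem_V0 {L : Submodule ℝ X} [FiniteDimensional ℝ L]
    {v0perp v0L v : X} (hv0perp : v0perp ∈ Lᗮ) (hv0L : v0L ∈ L) (hv0norm : ‖v0perp + v0L‖ = 1)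
    (hv : v ∈ V0 L v0L) : ‖v0perp‖ ≤ ‖Lᗮ.starProjection v‖ := by
  obtain ⟨hv1, w, hw, τ, hτ0, hτ1, rfl⟩ := hv
  have hτL := L.smul_mem τ hv0L
  rw [starProjection_orthogonal_add hw hτL]
  have e1 := norm_add_sq_real v0perp v0L
  have e2 := norm_add_sq_real w (τ • v0L)
  rw [Submodule.inner_left_of_mem_orthogonal hv0L hv0perp, hv0norm] at e1
  rw [Submodule.inner_left_of_mem_orthogonal hτL hw, hv1, norm_smul, Real.norm_eq_abs,
    abs_of_nonneg hτ0] at e2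
  have : τ * ‖v0L‖ ≤ ‖v0L‖ := mul_le_of_le_one_left (norm_nonneg _) hτ1
  have : (τ * ‖v0L‖) ^ 2 ≤ ‖v0L‖ ^ 2 := by gcongr
  exact le_of_sq_le_sq (by linarith) (norm_nonneg _)

theorem starProjection_smul_add {L : Submodule ℝ X} [FiniteDimensional ℝ L] {v w : X} (s : ℝ)
    (hw : w ∈ L) : Lᗮ.starProjection (s • v + w) = s • Lᗮ.starProjection v := by
  have : Lᗮ.starProjection w = 0 := by
    simpa using starProjection_orthogonal_add (L := L) (Submodule.zero_mem Lᗮ) hw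
  rw [map_add, map_smul, this, add_zero]

/-- The coefficient of the peak selection along `v` is continuous on `V0`. -/
theorem continuousOn_coeff {L : Submodule ℝ X} [FiniteDimensional ℝ L]
    {v0perp v0L : X} (hv0perp : v0perp ∈ Lᗮ) (hv0perp0 : v0perp ≠ 0) (hv0L : v0L ∈ L)
    (hv0norm : ‖v0perp + v0L‖ = 1) {p : X → X} {t : X → ℝ} {wL : X → X}
    (hdecomp : ∀ u : X, ‖u‖ = 1 → p u = t u • u + wL u ∧ 0 ≤ t u ∧ wL u ∈ L)
    (hpc : ContinuousOn p (V0 L v0L)) : ContinuousOn t (V0 L v0L) := by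
  have hpos : ∀ v ∈ V0 L v0L, ‖Lᗮ.starProjection v‖ ^ 2 ≠ 0 := fun v hv => by
    have := norm_le_norm_starProjection_of_mem_V0 hv0perp hv0L hv0norm hv
    exact pow_ne_zero 2 ((norm_pos_iff.2 hv0perp0).trans_le this).ne'
  have hc : ContinuousOn (fun v => ⟪Lᗮ.starProjection (p v), Lᗮ.starProjection v⟫ /
      ‖Lᗮ.starProjection v‖ ^ 2) (V0 L v0L) := by
    refine ContinuousOn.div (ContinuousOn.inner (𝕜 := ℝ) ?_ ?_) ?_ hpos
    · exact Lᗮ.starProjection.continuous.comp_continuousOn hpc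
    · exact Lᗮ.starProjection.continuous.continuousOn
    · exact (Lᗮ.starProjection.continuous.norm.pow 2).continuousOn
  refine hc.congr fun v hv => ?_
  obtain ⟨h1, -, h3⟩ := hdecomp v hv.1
  beta_reduce
  rw [h1, starProjection_smul_add _ h3, real_inner_smul_left, real_inner_self_eq_norm_sq,
    mul_div_cancel_right₀ _ (hpos v hv)]

variable [CompleteSpace X]

theorem inner_gradient_eq_zero_of_isLocalMaxOn {E : X → ℝ} {L : Submodule ℝ X} {v w : X} {s : ℝ}
    (hs : 0 < s) (hw : w ∈ L) (hE : DifferentiableAt ℝ E (s • v + w))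
    (hmax : IsLocalMaxOn E (halfspaceCone L v) (s • v + w)) (c : ℝ) {l : X} (hl : l ∈ L) :
    ⟪gradient E (s • v + w), c • v + l⟫ = 0 := by
  set x := s • v + w
  set d := c • v + l
  have hline : HasDerivAt (fun r : ℝ => x + r • d) d 0 := by
    simpa using ((hasDerivAt_id (0 : ℝ)).smul_const d).const_add x
  have hd : HasDerivAt (fun r : ℝ => E (x + r • d)) (fderiv ℝ E x d) 0 := by
    refine HasFDerivAt.comp_hasDerivAt (0 : ℝ) ?_ hline
    simpa using hE.hasFDerivAt
  rw [inner_gradient_left]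
  refine IsLocalMax.hasDerivAt_eq_zero ?_ hd
  have hcont : Tendsto (fun r : ℝ => x + r • d) (𝓝 0) (𝓝 x) := by
    simpa using hline.continuousAt.tendsto
  have hpos : ∀ᶠ r : ℝ in 𝓝 0, 0 < s + r * c := by
    have : Tendsto (fun r : ℝ => s + r * c) (𝓝 0) (𝓝 (s + 0 * c)) :=
      Continuous.tendsto (by fun_prop) 0
    exact this.eventually (lt_mem_nhds (by simpa using hs))
  have hmem : Tendsto (fun r : ℝ => x + r • d) (𝓝 0) (𝓝[halfspaceCone L v] x) := by
    refine tendsto_nhdsWithin_iff.2 ⟨hcont, hpos.mono fun r hr => ?_⟩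
    refine ⟨s + r * c, hr.le, w + r • l, L.add_mem hw (L.smul_mem r hl), ?_⟩
    simp only [x, d]
    module
  refine (hmem.eventually hmax).mono fun r hr => ?_
  simpa using hr

/-- Along the path `a ↦ stepv v g a`, a lower bound for the first-order decrease of the peak
energy integrates to a bound for the decrease itself. -/
theorem peak_energy_stepv_le {E : X → ℝ} (hE : ContDiff ℝ 1 E) {L : Submodule ℝ X} {v0L : X}
    {p : X → X} {t : X → ℝ} {wL : X → X}
    (hmax : ∀ u : X, ‖u‖ = 1 → IsLocalMaxOn E (halfspaceCone L u) (p u))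
    (hdecomp : ∀ u : X, ‖u‖ = 1 → p u = t u • u + wL u ∧ 0 ≤ t u ∧ wL u ∈ L)
    (hpc : ContinuousOn p (V0 L v0L)) (htc : ContinuousOn t (V0 L v0L))
    {v g : X} (hv : v ∈ V0 L v0L) (hg : g ∈ Lᗮ) (hvg : ⟪v, g⟫ = 0) {β c : ℝ} (hβ : 0 ≤ β)
    (hc : ∀ a ∈ Icc 0 β, c < t (stepv v g a) * ‖v - a • g‖⁻¹ *
      ⟪gradient E (p (stepv v g a)), g⟫) :
    E (p (stepv v g β)) ≤ E (p v) - c * β := by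
  have hne : ∀ a : ℝ, 0 < ‖v - a • g‖ := fun a =>
    one_pos.trans_le (one_le_norm_sub_smul hv.1 hvg a)
  have hF : Continuous (stepv v g) := by
    refine Continuous.smul (Continuous.inv₀ (by fun_prop) fun a => (hne a).ne') (by fun_prop)
  have hFm : ∀ a, stepv v g a ∈ V0 L v0L := stepv_mem_V0 hv hg hvg
  set q : ℝ → X := fun a => p (stepv v g a) with hq
  set s : ℝ → ℝ := fun a => t (stepv v g a) * ‖v - a • g‖⁻¹ with hs
  have hqc : Continuous q := hpc.comp_continuous hF hFm
  have hsc : Continuous s := (htc.comp_continuous hF hFm).mul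
    (Continuous.inv₀ (by fun_prop) fun a => (hne a).ne')
  have hqs : ∀ a, q a = s a • (v - a • g) + wL (stepv v g a) := fun a => by
    simp only [hq, hs]
    rw [(hdecomp _ (hFm a).1).1, mul_smul]
    rfl
  set f' : ℝ → ℝ := fun a => -(s a * ⟪gradient E (q a), g⟫) with hf'
  have key := image_le_of_liminf_slope_right_lt_deriv_boundary' (f := E ∘ q) (f' := f')
    (a := 0) (b := β) (hE.continuous.comp hqc).continuousOn ?_
    (B := fun a => E (p v) - c * a) (B' := fun _ => -c) ?_ (by fun_prop) ?_ ?_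
  · exact key (right_mem_Icc.2 hβ)
  · intro a _ r hr
    refine Eventually.frequently ?_
    set y : ℝ → X := fun z => q z + (s z * (z - a)) • g with hy
    have hyc : Tendsto y (𝓝 a) (𝓝 (q a)) := by
      have : Continuous y := by fun_prop
      simpa [hy] using this.tendsto a
    have hycone : ∀ z, y z ∈ halfspaceCone L (stepv v g a) := fun z => by
      refine ⟨s z * ‖v - a • g‖, mul_nonneg (mul_nonneg (hdecomp _ (hFm z).1).2.1
        (inv_nonneg.2 (norm_nonneg _))) (norm_nonneg _), wL (stepv v g z),
        (hdecomp _ (hFm z).1).2.2, ?_⟩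
      rw [stepv, smul_smul, mul_assoc, mul_inv_cancel₀ (hne a).ne', mul_one]
      simp only [hy, hqs z]
      module
    have hle : ∀ᶠ z in 𝓝 a, E (y z) ≤ E (q a) :=
      (tendsto_nhdsWithin_iff.2 ⟨hyc, Eventually.of_forall hycone⟩).eventually
        (hmax _ (hFm a).1)
    have hstrict := (hE.contDiffAt.hasStrictFDerivAt (x := q a) one_ne_zero).isLittleO.comp_tendsto
      (hqc.continuousAt.tendsto.prodMk_nhds hyc)
    have hsub : ∀ z, q z - y z = (z - a) • (-(s z) • g) := fun z => by
      simp only [hy]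
      module
    have hO : (fun z => q z - y z) =O[𝓝 a] fun z => z - a := by
      have h1 : (fun z => -(s z) • g) =O[𝓝 a] fun _ => (1 : ℝ) :=
        (Continuous.tendsto (by fun_prop) a : Tendsto (fun z => -(s z) • g) _ _).isBigO_one ℝ
      have h2 := (Asymptotics.isBigO_refl (fun z : ℝ => z - a) (𝓝 a)).smul h1
      simpa [hsub] using h2
    have hlim := (hstrict.trans_isBigO hO).tendsto_div_nhds_zero
    have hslim : Tendsto (fun z => -(s z * ⟪gradient E (q a), g⟫)) (𝓝 a) (𝓝 (f' a)) :=
      Continuous.tendsto (by fun_prop) a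
    have hsum := (hlim.add hslim).eventually (gt_mem_nhds (by simpa using hr))
    filter_upwards [self_mem_nhdsWithin, nhdsWithin_le_nhds hsum, nhdsWithin_le_nhds hle]
      with z hz h1 h2
    have hza : 0 < z - a := sub_pos.2 hz
    refine lt_of_le_of_lt ?_ h1
    simp only [Function.comp_apply, hsub z, ← inner_gradient_left, inner_smul_right]
    rw [slope_def_field, Function.comp_apply, Function.comp_apply, div_add' _ _ _ hza.ne']
    gcongr
    nlinarith
  · simp [hq, stepv_zero hv.1]
  · intro a _
    simpa using (((hasDerivAt_id a).const_mul c).const_sub (E (p v))).hasDerivWithinAt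
  · intro a ha _
    have := hc a ⟨ha.1, ha.2.le⟩
    simp only [hf', hs, hq]
    linarith

/-- The gradient at a peak off `L` is orthogonal to `L` and to the peak direction. -/
theorem gradient_peak_orthogonal {E : X → ℝ} (hE : ContDiff ℝ 1 E) {L : Submodule ℝ X}
    {p : X → X} {t : X → ℝ} {wL : X → X}
    (hmax : ∀ u : X, ‖u‖ = 1 → IsLocalMaxOn E (halfspaceCone L u) (p u))
    (hdecomp : ∀ u : X, ‖u‖ = 1 → p u = t u • u + wL u ∧ 0 ≤ t u ∧ wL u ∈ L)
    {v : X} (hv : ‖v‖ = 1) (htv : 0 < t v) :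
    gradient E (p v) ∈ Lᗮ ∧ ⟪v, gradient E (p v)⟫ = 0 := by
  obtain ⟨h1, -, h3⟩ := hdecomp v hv
  have h := fun c l (hl : l ∈ L) => inner_gradient_eq_zero_of_isLocalMaxOn htv h3
    (hE.differentiable one_ne_zero _) (h1 ▸ hmax v hv) c hl
  rw [← h1] at h
  refine ⟨(Submodule.mem_orthogonal' _ _).2 fun l hl => by simpa using h 0 l hl, ?_⟩
  rw [real_inner_comm]
  simpa using h 1 0 L.zero_mem

/-- Near a direction whose peak is not critical, all small steps satisfy the Armijo-type decrease
condition, uniformly in the direction. -/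
theorem exists_uniform_decrease {E : X → ℝ} (hE : ContDiff ℝ 1 E) {L : Submodule ℝ X} {v0L : X}
    {p : X → X} {t : X → ℝ} {wL : X → X}
    (hmax : ∀ u : X, ‖u‖ = 1 → IsLocalMaxOn E (halfspaceCone L u) (p u))
    (hdecomp : ∀ u : X, ‖u‖ = 1 → p u = t u • u + wL u ∧ 0 ≤ t u ∧ wL u ∈ L)
    (hpc : ContinuousOn p (V0 L v0L)) (htc : ContinuousOn t (V0 L v0L))
    {σ : ℝ} (hσ : σ < 1) {u : X} (hu : u ∈ V0 L v0L) (htu : 0 < t u)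
    (hgu : gradient E (p u) ≠ 0) :
    ∃ ε > 0, ∀ v ∈ V0 L v0L, dist v u < ε → 0 < t v → ∀ β, 0 ≤ β → β < ε →
      E (p (stepv v (gradient E (p v)) β)) ≤ E (p v) - σ * β * t v * ‖gradient E (p v)‖ ^ 2 := by
  have hgradc : Continuous (gradient E) :=
    (InnerProductSpace.toDual ℝ X).symm.continuous.comp (hE.continuous_fderiv one_ne_zero)
  set A : Set X := {v ∈ V0 L v0L | 0 < t v}
  have hAV : A ⊆ V0 L v0L := fun v hv => hv.1
  have horth : ∀ v ∈ A, gradient E (p v) ∈ Lᗮ ∧ ⟪v, gradient E (p v)⟫ = 0 := fun v hv =>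
    gradient_peak_orthogonal hE hmax hdecomp hv.1.1 hv.2
  set D : Set (X × ℝ) := A ×ˢ univ
  have hfst : MapsTo (Prod.fst : X × ℝ → X) D A := fun x hx => hx.1
  have hG : ContinuousOn (fun x : X × ℝ => gradient E (p x.1)) D :=
    hgradc.comp_continuousOn ((hpc.mono hAV).comp continuousOn_fst hfst)
  have hstep : ContinuousOn (fun x : X × ℝ => x.1 - x.2 • gradient E (p x.1)) D :=
    continuousOn_fst.sub (continuousOn_snd.smul hG)
  have hinv : ContinuousOn (fun x : X × ℝ => ‖x.1 - x.2 • gradient E (p x.1)‖⁻¹) D :=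
    hstep.norm.inv₀ fun x hx => (one_pos.trans_le
      (one_le_norm_sub_smul hx.1.1.1 (horth _ hx.1).2 _)).ne'
  have hF : ContinuousOn (fun x : X × ℝ => stepv x.1 (gradient E (p x.1)) x.2) D :=
    hinv.smul hstep
  have hFm : MapsTo (fun x : X × ℝ => stepv x.1 (gradient E (p x.1)) x.2) D (V0 L v0L) :=
    fun x hx => stepv_mem_V0 hx.1.1 (horth _ hx.1).1 (horth _ hx.1).2 _
  have hΦ : ContinuousOn (fun x : X × ℝ =>
      t (stepv x.1 (gradient E (p x.1)) x.2) * ‖x.1 - x.2 • gradient E (p x.1)‖⁻¹ *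
        ⟪gradient E (p (stepv x.1 (gradient E (p x.1)) x.2)), gradient E (p x.1)⟫ -
      σ * t x.1 * ‖gradient E (p x.1)‖ ^ 2) D := by
    refine ContinuousOn.sub (((htc.comp hF hFm).mul hinv).mul (ContinuousOn.inner (𝕜 := ℝ) ?_ hG))
      ((continuousOn_const.mul ((htc.mono hAV).comp continuousOn_fst hfst)).mul (hG.norm.pow 2))
    exact hgradc.comp_continuousOn (hpc.comp hF hFm)
  have hmem : (u, (0 : ℝ)) ∈ D := ⟨⟨hu, htu⟩, mem_univ _⟩
  have hpos := (hΦ _ hmem).eventually (lt_mem_nhds (a := 0) (by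
    have : 0 < ‖gradient E (p u)‖ ^ 2 := pow_pos (norm_pos_iff.2 hgu) 2
    simp only [stepv_zero hu.1, zero_smul, sub_zero, hu.1, inv_one, mul_one,
      real_inner_self_eq_norm_sq]
    have := mul_pos (sub_pos.2 hσ) (mul_pos htu this)
    linarith))
  obtain ⟨ε, hε, hball⟩ := Metric.mem_nhdsWithin_iff.1 hpos
  refine ⟨ε, hε, fun v hv hvu htv β hβ0 hβ => ?_⟩
  obtain ⟨h1, h2⟩ := horth v ⟨hv, htv⟩
  refine (peak_energy_stepv_le hE hmax hdecomp hpc htc hv h1 h2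
    (c := σ * t v * ‖gradient E (p v)‖ ^ 2) hβ0 fun a ha => ?_).trans_eq (by ring)
  have : (v, a) ∈ Metric.ball (u, (0 : ℝ)) ε ∩ D := by
    refine ⟨?_, ⟨hv, htv⟩, mem_univ _⟩
    rw [Metric.mem_ball, Prod.dist_eq, max_lt_iff, Real.dist_eq, sub_zero, abs_of_nonneg ha.1]
    exact ⟨hvu, ha.2.trans_lt hβ⟩
  exact sub_pos.1 (hball this)

/-- Zhang–Hager averages: the reference values dominate the energies, and if the averaging
parameters stay away from `1` and the energies are bounded below, the decreases are summable. -/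
theorem zhangHager_le_and_summable {e d Q C η : ℕ → ℝ} {ηmax : ℝ} (hηmax : ηmax < 1)
    (hη0 : ∀ k, 0 ≤ η k) (hη1 : ∀ k, η k ≤ ηmax) (hQ0 : Q 0 = 1) (hC0 : C 0 = e 0)
    (hd : ∀ k, 0 ≤ d k) (hdec : ∀ k, e (k + 1) ≤ C k - d k)
    (hrecQ : ∀ k, Q (k + 1) = η k * Q k + 1)
    (hrecC : ∀ k, C (k + 1) = (η k * Q k * C k + e (k + 1)) / Q (k + 1))
    (hbdd : BddBelow (range e)) : (∀ k, e k ≤ C k) ∧ Summable d := by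
  have hη' : 0 < 1 - ηmax := sub_pos.2 hηmax
  have hQ : ∀ k, 1 ≤ Q k ∧ Q k * (1 - ηmax) ≤ 1 := by
    intro k
    induction k with
    | zero => rw [hQ0]; exact ⟨le_rfl, by linarith [(hη0 0).trans (hη1 0)]⟩
    | succ k ih =>
      rw [hrecQ]
      have h1 : 0 ≤ η k * Q k := mul_nonneg (hη0 k) (by linarith)
      have h2 : η k * (Q k * (1 - ηmax)) ≤ ηmax * 1 :=
        mul_le_mul (hη1 k) ih.2 (mul_nonneg (by linarith) hη'.le) ((hη0 k).trans (hη1 k))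
      exact ⟨by linarith, by linarith⟩
  have hQpos : ∀ k, 0 < Q k := fun k => one_pos.trans_le (hQ k).1
  have hCQ : ∀ k, C (k + 1) * Q (k + 1) = η k * Q k * C k + e (k + 1) := fun k => by
    rw [hrecC, div_mul_cancel₀ _ (hQpos _).ne']
  have hle : ∀ k, e k ≤ C k := by
    intro k
    cases k with
    | zero => exact hC0.ge
    | succ k =>
      have h1 : 0 ≤ η k * Q k := mul_nonneg (hη0 k) (hQpos k).le
      have h2 : η k * Q k * e (k + 1) ≤ η k * Q k * C k :=
        mul_le_mul_of_nonneg_left (by linarith [hdec k, hd k]) h1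
      refine le_of_mul_le_mul_right ?_ (hQpos (k + 1))
      rw [hCQ, hrecQ]
      linarith
  have hstep : ∀ k, (1 - ηmax) * d k ≤ C k - C (k + 1) := by
    intro k
    have h1 : d k ≤ (C k - C (k + 1)) * Q (k + 1) := by
      have h2 : C k * Q (k + 1) = η k * Q k * C k + C k := by rw [hrecQ]; ring
      linarith [hCQ k, hdec k]
    have h2 : 0 ≤ C k - C (k + 1) := nonneg_of_mul_nonneg_left ((hd k).trans h1) (hQpos _)
    calc (1 - ηmax) * d k ≤ (1 - ηmax) * ((C k - C (k + 1)) * Q (k + 1)) := by gcongr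
      _ = (C k - C (k + 1)) * (Q (k + 1) * (1 - ηmax)) := by ring
      _ ≤ _ := mul_le_of_le_one_right h2 (hQ _).2
  obtain ⟨b, hb⟩ := hbdd
  refine ⟨hle, (summable_mul_left_iff hη'.ne').1
    (summable_of_sum_range_le (c := C 0 - b) (fun k => mul_nonneg hη'.le (hd k)) fun n => ?_)⟩
  calc _ ≤ ∑ k ∈ Finset.range n, (C k - C (k + 1)) := Finset.sum_le_sum fun k _ => hstep k
    _ = C 0 - C n := Finset.sum_range_sub' C n
    _ ≤ C 0 - b := by linarith [hb (mem_range_self n), hle n]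

end Auxiliary

/-- Theorem 3.6 (c),(d),(e): for the normalized ZH-type nonmonotone
LMM with `η_max < 1`, `∑ α_k ‖g_k‖² < ∞`, every accumulation point of `{w_k}` is a
critical point of `E` not in `L`, and `liminf ‖g_k‖ = 0` (i.e. some subsequence of
`‖g_k‖` tends to `0`). -/
theorem statement14
    {X : Type*} [NormedAddCommGroup X] [InnerProductSpace ℝ X] [CompleteSpace X]
    (E : X → ℝ) (hE : ContDiff ℝ 1 E)
    (L : Submodule ℝ X) [FiniteDimensional ℝ L]
    (v0perp v0L : X) (hv0perp : v0perp ∈ Lᗮ) (hv0perp0 : v0perp ≠ 0) (hv0L : v0L ∈ L)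
    (hv0norm : ‖v0perp + v0L‖ = 1)
    (p : X → X)
    (hpsel : ∀ u : X, ‖u‖ = 1 →
      p u ∈ halfspaceCone L u ∧ IsLocalMaxOn E (halfspaceCone L u) (p u))
    (t : X → ℝ) (wL : X → X)
    (hdecomp : ∀ u : X, ‖u‖ = 1 → p u = t u • u + wL u ∧ 0 ≤ t u ∧ wL u ∈ L)
    (σ ρ : ℝ) (hσ : σ ∈ Set.Ioo (0 : ℝ) 1) (hρ : ρ ∈ Set.Ioo (0 : ℝ) 1)
    (lmin lmax : ℝ) (hlmin : 0 < lmin) (hlle : lmin ≤ lmax)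
    (ηmin ηmax : ℝ) (hηmin : 0 ≤ ηmin) (hηlt : ηmin < ηmax) (hηmax : ηmax ≤ 1)
    (hηmax1 : ηmax < 1)
    (lam η : ℕ → ℝ) (m : ℕ → ℕ) (α : ℕ → ℝ)
    (hlam : ∀ k, lam k ∈ Set.Icc lmin lmax)
    (hη : ∀ k, η k ∈ Set.Icc ηmin ηmax)
    (v : ℕ → X) (Q C : ℕ → ℝ)
    (hv00 : v 0 = v0perp + v0L)
    (hQ0 : Q 0 = 1) (hC0 : C 0 = E (p (v 0)))
    (hαdef : ∀ k, α k = lam k * ρ ^ m k)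
    (hZH : ∀ k : ℕ,
      E (p (stepv (v k) (gradient E (p (v k))) (α k))) ≤
        C k - σ * α k * t (v k) * ‖gradient E (p (v k))‖ ^ 2)
    (hmmin : ∀ k : ℕ, ∀ m' < m k,
      ¬ (E (p (stepv (v k) (gradient E (p (v k))) (lam k * ρ ^ m'))) ≤
        C k - σ * (lam k * ρ ^ m') * t (v k) * ‖gradient E (p (v k))‖ ^ 2))
    (hrecv : ∀ k, v (k + 1) = stepv (v k) (gradient E (p (v k))) (α k))
    (hrecQ : ∀ k, Q (k + 1) = η k * Q k + 1)
    (hrecC : ∀ k, C (k + 1) = (η k * Q k * C k + E (p (v (k + 1)))) / Q (k + 1))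
    (hV0 : ∀ k, v k ∈ V0 L v0L)
    (hpc : ContinuousOn p (V0 L v0L))
    (δ : ℝ) (hδ : 0 < δ) (ht : ∀ k, δ ≤ t (v k))
    (hbdd : BddBelow (Set.range fun k => E (p (v k)))) :
    Summable (fun k => α k * ‖gradient E (p (v k))‖ ^ 2) ∧
    (∀ u : X, (∃ φ : ℕ → ℕ, StrictMono φ ∧
        Tendsto (fun i => p (v (φ i))) atTop (nhds u)) →
      u ∉ L ∧ fderiv ℝ E u = 0) ∧
    ∃ φ : ℕ → ℕ, StrictMono φ ∧
      Tendsto (fun i => ‖gradient E (p (v (φ i)))‖) atTop (nhds 0) := by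
  have hmax : ∀ u : X, ‖u‖ = 1 → IsLocalMaxOn E (halfspaceCone L u) (p u) :=
    fun u hu => (hpsel u hu).2
  have htc : ContinuousOn t (V0 L v0L) :=
    continuousOn_coeff hv0perp hv0perp0 hv0L hv0norm hdecomp hpc
  have hgradc : Continuous (gradient E) :=
    (InnerProductSpace.toDual ℝ X).symm.continuous.comp (hE.continuous_fderiv one_ne_zero)
  have htpos : ∀ k, 0 < t (v k) := fun k => hδ.trans_le (ht k)
  have horth := fun k => gradient_peak_orthogonal hE hmax hdecomp (hV0 k).1 (htpos k)
  have hαpos : ∀ k, 0 < α k := fun k => by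
    rw [hαdef]
    exact mul_pos (hlmin.trans_le (hlam k).1) (pow_pos hρ.1 _)
  have hd : ∀ k, 0 ≤ σ * α k * t (v k) * ‖gradient E (p (v k))‖ ^ 2 := fun k => by
    have := hαpos k
    have := htpos k
    have := hσ.1
    positivity
  obtain ⟨hEC, hsumd⟩ := zhangHager_le_and_summable (e := fun k => E (p (v k))) hηmax1
    (fun k => hηmin.trans (hη k).1) (fun k => (hη k).2) hQ0 hC0 hd
    (fun k => by simpa only [hrecv] using hZH k) hrecQ hrecC hbdd
  have hsum : Summable (fun k => α k * ‖gradient E (p (v k))‖ ^ 2) := by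
    refine Summable.of_nonneg_of_le (fun k => mul_nonneg (hαpos k).le (sq_nonneg _)) (fun k => ?_)
      (hsumd.mul_left (σ * δ)⁻¹)
    have hσδ : 0 < σ * δ := mul_pos hσ.1 hδ
    rw [inv_mul_eq_div, le_div_iff₀ hσδ]
    have h1 : 0 ≤ σ * (α k * ‖gradient E (p (v k))‖ ^ 2) :=
      mul_nonneg hσ.1.le (mul_nonneg (hαpos k).le (sq_nonneg _))
    have h2 := mul_le_mul_of_nonneg_left (ht k) h1
    linarith
  have hcrit : ∀ (φ : ℕ → ℕ), StrictMono φ → ∀ u ∈ V0 L v0L,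
      Tendsto (fun i => v (φ i)) atTop (𝓝 u) → gradient E (p u) = 0 := by
    intro φ hφ u hu hvu
    by_contra hgu
    have hvu' : Tendsto (fun i => v (φ i)) atTop (𝓝[V0 L v0L] u) :=
      tendsto_nhdsWithin_iff.2 ⟨hvu, Eventually.of_forall fun i => hV0 _⟩
    have htu : 0 < t u := hδ.trans_le
      (ge_of_tendsto ((htc u hu).tendsto.comp hvu') (Eventually.of_forall fun i => ht _))
    obtain ⟨ε, hε, hdecr⟩ := exists_uniform_decrease hE hmax hdecomp hpc htc hσ.2 hu htu hgu
    have hgsq : Tendsto (fun i => ‖gradient E (p (v (φ i)))‖ ^ 2) atTop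
        (𝓝 (‖gradient E (p u)‖ ^ 2)) :=
      (((hgradc.tendsto _).comp ((hpc u hu).tendsto.comp hvu')).norm.pow 2)
    have hgu2 : ‖gradient E (p u)‖ ^ 2 ≠ 0 := pow_ne_zero 2 (norm_ne_zero_iff.2 hgu)
    have hα0 : Tendsto (fun i => α (φ i)) atTop (𝓝 0) := by
      have h := (hsum.tendsto_atTop_zero.comp hφ.tendsto_atTop).div hgsq hgu2
      rw [zero_div] at h
      refine h.congr' ?_
      filter_upwards [hgsq.eventually_ne hgu2] with i hi
      exact mul_div_cancel_right₀ _ hi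
    have hαρ : Tendsto (fun i => α (φ i) / ρ) atTop (𝓝 0) := by simpa using hα0.div_const ρ
    obtain ⟨i, h1, h2, h3⟩ := ((hα0.eventually (gt_mem_nhds hlmin)).and
      ((hαρ.eventually (gt_mem_nhds hε)).and
        (hvu.eventually (Metric.ball_mem_nhds u hε)))).exists
    have hm : m (φ i) ≠ 0 := fun h => by
      have := hαdef (φ i)
      rw [h, pow_zero, mul_one] at this
      linarith [(hlam (φ i)).1]
    obtain ⟨n, hn⟩ := Nat.exists_eq_succ_of_ne_zero hm
    have hβ : lam (φ i) * ρ ^ n = α (φ i) / ρ := by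
      rw [hαdef, hn, pow_succ, ← mul_assoc, mul_div_cancel_right₀ _ hρ.1.ne']
    have hfail := hmmin (φ i) n (by omega)
    rw [hβ] at hfail
    refine hfail ((hdecr _ (hV0 _) h3 (htpos _) _ (div_pos (hαpos _) hρ.1).le h2).trans ?_)
    exact sub_le_sub_right (hEC (φ i)) _
  refine ⟨hsum, ?_, ?_⟩
  · rintro u ⟨φ, hφ, hu⟩
    have hPw : ∀ k, Lᗮ.starProjection (p (v k)) = t (v k) • Lᗮ.starProjection (v k) := fun k => by
      obtain ⟨h1, -, h3⟩ := hdecomp _ (hV0 k).1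
      rw [h1, starProjection_smul_add _ h3]
    have hPu := (Lᗮ.starProjection.continuous.tendsto u).comp hu
    refine ⟨fun huL => ?_, ?_⟩
    · have h0 : Lᗮ.starProjection u = 0 := by
        simpa using starProjection_orthogonal_add (L := L) (Submodule.zero_mem Lᗮ) huL
      have hlow : δ * ‖v0perp‖ ≤ ‖Lᗮ.starProjection u‖ := by
        refine ge_of_tendsto hPu.norm (Eventually.of_forall fun i => ?_)
        simp only [Function.comp_apply]
        rw [hPw, norm_smul, Real.norm_eq_abs, abs_of_pos (htpos _)]
        exact mul_le_mul (ht _)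
          (norm_le_norm_starProjection_of_mem_V0 hv0perp hv0L hv0norm (hV0 _))
          (norm_nonneg _) (htpos _).le
      rw [h0, norm_zero] at hlow
      exact absurd hlow (mul_pos hδ (norm_pos_iff.2 hv0perp0)).not_ge
    · choose w hw τ hτ0 hτ1 hvw using fun k => (hV0 k).2
      have hvP : ∀ k, v k = (t (v k))⁻¹ • Lᗮ.starProjection (p (v k)) + τ k • v0L := fun k => by
        rw [hPw, inv_smul_smul₀ (htpos k).ne']
        have : Lᗮ.starProjection (v k) = w k := by
          rw [hvw k, starProjection_orthogonal_add (hw k) (L.smul_mem _ hv0L)]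
        rw [this, ← hvw]
      obtain ⟨⟨r, τ'⟩, -, ψ, hψ, hlim⟩ :=
        (isCompact_Icc.prod isCompact_Icc :
          IsCompact (Icc (0 : ℝ) δ⁻¹ ×ˢ Icc (0 : ℝ) 1)).tendsto_subseq
          (x := fun i => ((t (v (φ i)))⁻¹, τ (φ i)))
          fun i => ⟨⟨(inv_pos.2 (htpos _)).le, inv_anti₀ hδ (ht _)⟩, hτ0 _, hτ1 _⟩
      have hr := (continuous_fst.tendsto _).comp hlim
      have hτ := (continuous_snd.tendsto _).comp hlim
      have hv : Tendsto (fun i => v (φ (ψ i))) atTop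
          (𝓝 (r • Lᗮ.starProjection u + τ' • v0L)) := by
        refine ((hr.smul (hPu.comp hψ.tendsto_atTop)).add (hτ.smul_const v0L)).congr fun i => ?_
        exact (hvP _).symm
      have hmem := (isClosed_V0 L v0L).mem_of_tendsto hv (Eventually.of_forall fun i => hV0 _)
      have hp := (hpc _ hmem).tendsto.comp
        (tendsto_nhdsWithin_iff.2 ⟨hv, Eventually.of_forall fun i => hV0 _⟩)
      have heq := tendsto_nhds_unique (hu.comp hψ.tendsto_atTop) hp
      have hg := hcrit _ (hφ.comp hψ) _ hmem hv
      rw [← heq] at hg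
      simpa [gradient] using hg
  · have hcluster : MapClusterPt 0 atTop (fun k => ‖gradient E (p (v k))‖) := by
      rw [Metric.nhds_basis_ball.mapClusterPt_iff_frequently]
      intro ε hε
      by_contra hnot
      have hlow : ∀ᶠ k in atTop, ε ≤ ‖gradient E (p (v k))‖ := by
        simpa using not_frequently.1 hnot
      obtain ⟨N, hN⟩ := eventually_atTop.1 hlow
      have hcauchy : CauchySeq (fun k => v (k + N)) := by
        refine cauchySeq_of_dist_le_of_summable
          (fun k => 2 / ε * (α (k + N) * ‖gradient E (p (v (k + N)))‖ ^ 2)) (fun k => ?_)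
          (((summable_nat_add_iff N).2 hsum).mul_left _)
        rw [dist_comm, dist_eq_norm, Nat.succ_eq_add_one, add_right_comm, hrecv]
        refine (norm_stepv_sub_le (hV0 _).1 (horth _).2 _).trans ?_
        rw [norm_smul, Real.norm_eq_abs, abs_of_pos (hαpos _), div_mul_eq_mul_div,
          le_div_iff₀ hε]
        have h1 := mul_le_mul_of_nonneg_left (hN (k + N) (Nat.le_add_left N k))
          (mul_nonneg (hαpos (k + N)).le (norm_nonneg (gradient E (p (v (k + N))))))
        linarith
      obtain ⟨u, hu⟩ := cauchySeq_tendsto_of_complete hcauchy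
      have hmem := (isClosed_V0 L v0L).mem_of_tendsto hu (Eventually.of_forall fun i => hV0 _)
      have hg := hcrit _ (strictMono_id.add_const N) u hmem hu
      have hlim := ((hgradc.tendsto _).comp ((hpc u hmem).tendsto.comp
        (tendsto_nhdsWithin_iff.2 ⟨hu, Eventually.of_forall fun i => hV0 _⟩))).norm
      have := ge_of_tendsto hlim (Eventually.of_forall fun k => hN (k + N) (Nat.le_add_left N k))
      rw [hg, norm_zero] at this
      exact this.not_gt hε
    exact hcluster.tendsto_subseq
end
end
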